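/- The function F̃_n is smooth on ℝⁿ × (0,∞) and satisfies the backward heat equation ∂_t F̃_n(x,t) = (1/2) Σ_{j=1}^n ∂²F̃_n/∂x_j²(x,t) for every x ∈ ℝⁿ and every t > 0. -/

import Mathlib

open MeasureTheory Filter Set

/-- The point on the vertical contour `Γ_a` at height `φ`. -/
noncomputable def lineZ (a φ : ℝ) : ℂ := (a : ℂ) + φ * Complex.I

/-- The contour-integral formula `F̃_n(x,t)` with nested contours `Γ_{a_1}, …, Γ_{a_n}`;
each contour integral carries the conventional prefactor `1/(2πi)`, i.e. it is
`(1/(2π)) ∫_ℝ dφ` of the integrand evaluated at `a_j + iφ`. -/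
noncomputable def Ftilde (n : ℕ) (τ : ℝ) (a : Fin n → ℝ) (x : Fin n → ℝ) (t : ℝ) : ℂ :=
  (τ : ℂ) ^ (n * (n - 1) / 2) * (1 / (2 * Real.pi)) ^ n *
    ∫ φ : Fin n → ℝ,
      (∏ j : Fin n,
        (1 / lineZ (a j) (φ j)) * (((τ : ℂ) - 1) / (lineZ (a j) (φ j) + (1 - (τ : ℂ)))) *
          Complex.exp ((x j : ℂ) * lineZ (a j) (φ j) + (t : ℂ) / 2 * lineZ (a j) (φ j) ^ 2)) *
      ∏ pr ∈ Finset.univ.filter (fun pr : Fin n × Fin n => pr.1 < pr.2),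
        ((lineZ (a pr.2) (φ pr.2) - lineZ (a pr.1) (φ pr.1)) /
          (lineZ (a pr.2) (φ pr.2) - (τ : ℂ) * lineZ (a pr.1) (φ pr.1)))

open scoped Topology

section ExponentialIntegral

variable {Ω E : Type*} [MeasurableSpace Ω] [NormedAddCommGroup E] [NormedSpace ℝ E]

/-- `G` is an amplitude for which the integrals of `exp (L ω p) * G ω`, multiplied by any power of
`‖L ω‖`, are dominated locally uniformly in `p ∈ U`. -/
structure IsDominatedAmplitude (μ : Measure Ω) (L : Ω → E →L[ℝ] ℂ) (U : Set E) (G : Ω → ℂ) :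
    Prop where
  aestronglyMeasurable : AEStronglyMeasurable G μ
  exists_bound : ∀ p₀ ∈ U, ∀ k : ℕ, ∃ b : Ω → ℝ, Integrable b μ ∧
    ∀ᶠ p in 𝓝 p₀, ∀ ω, ‖L ω‖ ^ k * (‖Complex.exp (L ω p)‖ * ‖G ω‖) ≤ b ω

namespace IsDominatedAmplitude

variable {μ : Measure Ω} {L : Ω → E →L[ℝ] ℂ} {U : Set E} {G : Ω → ℂ}

lemma aestronglyMeasurable_integrand (hL : AEStronglyMeasurable L μ)
    (hG : IsDominatedAmplitude μ L U G) (p : E) :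
    AEStronglyMeasurable (fun ω => Complex.exp (L ω p) * G ω) μ :=
  (Complex.continuous_exp.comp_aestronglyMeasurable (hL.apply_continuousLinearMap p)).mul
    hG.aestronglyMeasurable

lemma integrable (hL : AEStronglyMeasurable L μ) (hG : IsDominatedAmplitude μ L U G)
    {p : E} (hp : p ∈ U) : Integrable (fun ω => Complex.exp (L ω p) * G ω) μ := by
  obtain ⟨b, hb, hbound⟩ := hG.exists_bound p hp 0
  refine hb.mono' (hG.aestronglyMeasurable_integrand hL p) (ae_of_all _ fun ω => ?_)
  simpa using hbound.self_of_nhds ω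

lemma apply_mul (hL : AEStronglyMeasurable L μ) (hG : IsDominatedAmplitude μ L U G) (e : E) :
    IsDominatedAmplitude μ L U (fun ω => L ω e * G ω) where
  aestronglyMeasurable := (hL.apply_continuousLinearMap e).mul hG.aestronglyMeasurable
  exists_bound p₀ hp₀ k := by
    obtain ⟨b, hb, hbound⟩ := hG.exists_bound p₀ hp₀ (k + 1)
    refine ⟨fun ω => ‖e‖ * b ω, hb.const_mul _, hbound.mono fun p hp ω => ?_⟩
    calc ‖L ω‖ ^ k * (‖Complex.exp (L ω p)‖ * ‖L ω e * G ω‖)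
        = ‖L ω‖ ^ k * (‖Complex.exp (L ω p)‖ * (‖L ω e‖ * ‖G ω‖)) := by rw [norm_mul]
      _ ≤ ‖L ω‖ ^ k * (‖Complex.exp (L ω p)‖ * (‖L ω‖ * ‖e‖ * ‖G ω‖)) := by
          gcongr
          exact (L ω).le_opNorm e
      _ = ‖e‖ * (‖L ω‖ ^ (k + 1) * (‖Complex.exp (L ω p)‖ * ‖G ω‖)) := by ring
      _ ≤ ‖e‖ * b ω := by gcongr; exact hp ω

lemma exists_hasFDerivAt (hL : AEStronglyMeasurable L μ) (hG : IsDominatedAmplitude μ L U G)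
    {p : E} (hp : p ∈ U) :
    ∃ D : E →L[ℝ] ℂ, HasFDerivAt (fun q => ∫ ω, Complex.exp (L ω q) * G ω ∂μ) D p ∧
      ∀ e, D e = ∫ ω, Complex.exp (L ω p) * (L ω e * G ω) ∂μ := by
  obtain ⟨b, hb, hbound⟩ := hG.exists_bound p hp 1
  have hmeas : AEStronglyMeasurable (fun ω => (Complex.exp (L ω p) * G ω) • L ω) μ :=
    (hG.aestronglyMeasurable_integrand hL p).smul hL
  have hle : ∀ q ω, ‖L ω‖ ^ 1 * (‖Complex.exp (L ω q)‖ * ‖G ω‖) ≤ b ω →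
      ‖(Complex.exp (L ω q) * G ω) • L ω‖ ≤ b ω := fun q ω h => by
    rw [norm_smul, norm_mul]
    linarith
  have hint : Integrable (fun ω => (Complex.exp (L ω p) * G ω) • L ω) μ :=
    hb.mono' hmeas (ae_of_all _ fun ω => hle p ω (hbound.self_of_nhds ω))
  refine ⟨_, hasFDerivAt_integral_of_dominated_of_fderiv_le (𝕜 := ℝ)
    (F := fun q ω => Complex.exp (L ω q) * G ω)
    (F' := fun q ω => (Complex.exp (L ω q) * G ω) • L ω) (bound := b) hbound
    (Eventually.of_forall fun q => hG.aestronglyMeasurable_integrand hL q)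
    (hG.integrable hL hp) hmeas (ae_of_all _ fun ω q hq => hle q ω (hq ω)) hb
    (ae_of_all _ fun ω q _ => ?_), fun e => ?_⟩
  · have h := ((L ω).hasFDerivAt (x := q)).cexp.mul_const (G ω)
    refine h.congr_fderiv ?_
    rw [smul_smul, mul_comm]
  · rw [ContinuousLinearMap.integral_apply hint]
    refine integral_congr_ae (ae_of_all _ fun ω => ?_)
    simp only [smul_apply, smul_eq_mul]
    ring

lemma hasDerivAt_comp (hL : AEStronglyMeasurable L μ) (hG : IsDominatedAmplitude μ L U G)
    {γ : ℝ → E} {e : E} {s : ℝ} (hγ : HasDerivAt γ e s) (hs : γ s ∈ U) :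
    HasDerivAt (fun r => ∫ ω, Complex.exp (L ω (γ r)) * G ω ∂μ)
      (∫ ω, Complex.exp (L ω (γ s)) * (L ω e * G ω) ∂μ) s := by
  obtain ⟨D, hD, hDe⟩ := hG.exists_hasFDerivAt hL hs
  rw [← hDe]
  exact hD.comp_hasDerivAt s hγ

lemma contDiffOn [FiniteDimensional ℝ E] (hU : IsOpen U) (hL : AEStronglyMeasurable L μ)
    (hG : IsDominatedAmplitude μ L U G) :
    ContDiffOn ℝ (⊤ : ℕ∞) (fun p => ∫ ω, Complex.exp (L ω p) * G ω ∂μ) U := by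
  refine contDiffOn_infty.2 fun m => ?_
  induction m generalizing G with
  | zero =>
    refine contDiffOn_zero.2 fun p hp => ?_
    obtain ⟨D, hD, -⟩ := hG.exists_hasFDerivAt hL hp
    exact hD.continuousAt.continuousWithinAt
  | succ m ih =>
    push_cast
    refine contDiffOn_succ_of_fderiv_apply (fun p hp => ?_) (by simp) fun e => ?_
    · obtain ⟨D, hD, -⟩ := hG.exists_hasFDerivAt hL hp
      exact hD.differentiableAt.differentiableWithinAt
    · refine (ih (hG.apply_mul hL e)).congr fun p hp => ?_
      obtain ⟨D, hD, hDe⟩ := hG.exists_hasFDerivAt hL hp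
      rw [fderivWithin_of_isOpen hU hp, hD.fderiv, hDe]

end IsDominatedAmplitude

end ExponentialIntegral

section PolynomialGrowth

variable {W V : Type*} [SeminormedAddCommGroup W] [SeminormedAddCommGroup V]

/-- `f` is bounded by a polynomial in the norm of its argument. -/
def HasPolynomialGrowth (f : W → V) : Prop :=
  ∃ (C : ℝ) (m : ℕ), 0 ≤ C ∧ ∀ w, ‖f w‖ ≤ C * (1 + ‖w‖) ^ m

namespace HasPolynomialGrowth

lemma of_bound {f : W → V} (C : ℝ) (h : ∀ w, ‖f w‖ ≤ C) : HasPolynomialGrowth f :=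
  ⟨C, 0, (norm_nonneg _).trans (h 0), fun w => by simpa using h w⟩

lemma of_norm_le {V' : Type*} [SeminormedAddCommGroup V'] {f : W → V} {g : W → V'}
    (hg : HasPolynomialGrowth g) (h : ∀ w, ‖f w‖ ≤ ‖g w‖) : HasPolynomialGrowth f := by
  obtain ⟨C, m, hC, hg⟩ := hg
  exact ⟨C, m, hC, fun w => (h w).trans (hg w)⟩

lemma add {f g : W → V} (hf : HasPolynomialGrowth f) (hg : HasPolynomialGrowth g) :
    HasPolynomialGrowth (fun w => f w + g w) := by
  obtain ⟨C, m, hC, hf⟩ := hf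
  obtain ⟨D, k, hD, hg⟩ := hg
  refine ⟨C + D, m + k, by positivity, fun w => ?_⟩
  have h1 : 1 ≤ 1 + ‖w‖ := by linarith [norm_nonneg w]
  calc ‖f w + g w‖ ≤ C * (1 + ‖w‖) ^ m + D * (1 + ‖w‖) ^ k :=
        (norm_add_le _ _).trans (add_le_add (hf w) (hg w))
    _ ≤ C * (1 + ‖w‖) ^ (m + k) + D * (1 + ‖w‖) ^ (m + k) := by
        gcongr <;> first | exact h1 | omega
    _ = (C + D) * (1 + ‖w‖) ^ (m + k) := by ring

lemma sum {ι : Type*} (s : Finset ι) {f : ι → W → V} (hf : ∀ i ∈ s, HasPolynomialGrowth (f i)) :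
    HasPolynomialGrowth (fun w => ∑ i ∈ s, f i w) := by
  classical
  induction s using Finset.induction_on with
  | empty => exact of_bound 0 (by simp)
  | insert i s hi ih =>
    simp only [Finset.sum_insert hi]
    exact (hf i (by simp)).add (ih fun j hj => hf j (by simp [hj]))

lemma smul {𝕜 : Type*} [NormedField 𝕜] [NormedSpace 𝕜 V] {f : W → 𝕜} {g : W → V}
    (hf : HasPolynomialGrowth f) (hg : HasPolynomialGrowth g) :
    HasPolynomialGrowth (fun w => f w • g w) := by
  obtain ⟨C, m, hC, hf⟩ := hf
  obtain ⟨D, k, hD, hg⟩ := hg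
  refine ⟨C * D, m + k, by positivity, fun w => ?_⟩
  calc ‖f w • g w‖ ≤ (C * (1 + ‖w‖) ^ m) * (D * (1 + ‖w‖) ^ k) := by
        rw [norm_smul]
        gcongr
        · exact hf w
        · exact hg w
    _ = C * D * (1 + ‖w‖) ^ (m + k) := by ring

lemma mul {f g : W → ℂ} (hf : HasPolynomialGrowth f) (hg : HasPolynomialGrowth g) :
    HasPolynomialGrowth (fun w => f w * g w) :=
  hf.smul hg

lemma prod {ι : Type*} (s : Finset ι) {f : ι → W → ℂ} (hf : ∀ i ∈ s, HasPolynomialGrowth (f i)) :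
    HasPolynomialGrowth (fun w => ∏ i ∈ s, f i w) := by
  classical
  induction s using Finset.induction_on with
  | empty => exact of_bound 1 (by simp)
  | insert i s hi ih =>
    simp only [Finset.prod_insert hi]
    exact (hf i (by simp)).mul (ih fun j hj => hf j (by simp [hj]))

lemma const (v : V) : HasPolynomialGrowth (fun _ : W => v) :=
  of_bound ‖v‖ fun _ => le_rfl

lemma inv_of_le_re {f : W → ℂ} {c : ℝ} (hc : 0 < c) (h : ∀ w, c ≤ |(f w).re|) :
    HasPolynomialGrowth (fun w => (f w)⁻¹) :=
  of_bound c⁻¹ fun w => by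
    rw [norm_inv]
    exact inv_anti₀ hc ((h w).trans (Complex.abs_re_le_norm _))

end HasPolynomialGrowth

end PolynomialGrowth

lemma norm_sq_le_sum_sq {ι : Type*} [Fintype ι] (φ : ι → ℝ) : ‖φ‖ ^ 2 ≤ ∑ j, φ j ^ 2 := by
  have hsum : 0 ≤ ∑ j, φ j ^ 2 := Finset.sum_nonneg fun j _ => sq_nonneg _
  rw [← Real.le_sqrt (norm_nonneg _) hsum, pi_norm_le_iff_of_nonneg (Real.sqrt_nonneg _)]
  intro j
  refine Real.abs_le_sqrt ?_
  exact Finset.single_le_sum (f := fun j => φ j ^ 2) (fun i _ => sq_nonneg _) (Finset.mem_univ j)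

lemma integrable_pow_one_add_norm_mul_exp_neg_mul_sum_sq {ι : Type*} [Fintype ι] (m : ℕ) {c : ℝ}
    (hc : 0 < c) :
    Integrable (fun φ : ι → ℝ => (1 + ‖φ‖) ^ m * Real.exp (-c * ∑ j, φ j ^ 2)) := by
  have hgauss : Integrable (fun φ : ι → ℝ => ∏ j, Real.exp (-(c / 2) * φ j ^ 2)) :=
    Integrable.fintype_prod (f := fun (_ : ι) s => Real.exp (-(c / 2) * s ^ 2))
      fun _ => integrable_exp_neg_mul_sq (half_pos hc)
  refine (hgauss.const_mul (m.factorial * Real.exp (1 + 1 / (2 * c)))).mono'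
    (by fun_prop) (ae_of_all _ fun φ => ?_)
  have hφ := norm_nonneg φ
  have hpow : (1 + ‖φ‖) ^ m ≤ m.factorial * Real.exp (1 + ‖φ‖) := by
    have h := Real.pow_div_factorial_le_exp (1 + ‖φ‖) (by positivity) m
    rwa [div_le_iff₀' (by positivity)] at h
  have hexponent : 1 + ‖φ‖ - c * ∑ j, φ j ^ 2 ≤
      1 + 1 / (2 * c) - c / 2 * ∑ j, φ j ^ 2 := by
    have hsq := mul_le_mul_of_nonneg_left (norm_sq_le_sum_sq φ) (half_pos hc).le
    have hamgm : ‖φ‖ ≤ 1 / (2 * c) + c / 2 * ‖φ‖ ^ 2 := by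
      have : 1 / (2 * c) + c / 2 * ‖φ‖ ^ 2 - ‖φ‖ = (c * ‖φ‖ - 1) ^ 2 / (2 * c) := by
        field_simp
        ring
      have : 0 ≤ (c * ‖φ‖ - 1) ^ 2 / (2 * c) := by positivity
      linarith
    linarith
  rw [Real.norm_of_nonneg (by positivity), ← Real.exp_sum, ← Finset.mul_sum]
  calc (1 + ‖φ‖) ^ m * Real.exp (-c * ∑ j, φ j ^ 2)
      ≤ m.factorial * Real.exp (1 + ‖φ‖) * Real.exp (-c * ∑ j, φ j ^ 2) := by gcongr
    _ = m.factorial * Real.exp (1 + ‖φ‖ - c * ∑ j, φ j ^ 2) := by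
        rw [mul_assoc, ← Real.exp_add]
        ring_nf
    _ ≤ m.factorial * Real.exp (1 + 1 / (2 * c) - c / 2 * ∑ j, φ j ^ 2) := by gcongr
    _ = m.factorial * Real.exp (1 + 1 / (2 * c)) * Real.exp (-(c / 2) * ∑ j, φ j ^ 2) := by
        rw [mul_assoc, ← Real.exp_add]
        ring_nf

section Contours

variable {n : ℕ}

@[simp] lemma lineZ_re (a φ : ℝ) : (lineZ a φ).re = a := by simp [lineZ]

@[fun_prop] lemma continuous_lineZ (a : ℝ) : Continuous (lineZ a) := by
  unfold lineZ
  fun_prop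

lemma lineZ_sq_re (a φ : ℝ) : (lineZ a φ ^ 2).re = a ^ 2 - φ ^ 2 := by
  simp [lineZ, sq]

lemma hasPolynomialGrowth_lineZ (a : ℝ) (j : Fin n) :
    HasPolynomialGrowth (fun φ : Fin n → ℝ => lineZ a (φ j)) := by
  refine (HasPolynomialGrowth.const (a : ℂ)).add ⟨1, 1, zero_le_one, fun φ => ?_⟩
  have h := norm_le_pi_norm φ j
  simp only [norm_mul, Complex.norm_real, Complex.norm_I, mul_one, one_mul, pow_one]
  linarith

/-- The exponent `∑ j, x_j z_j + t z_j² / 2` as a linear form in `(x, t)`. -/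
noncomputable def contourPhase (a φ : Fin n → ℝ) : ((Fin n → ℝ) × ℝ) →L[ℝ] ℂ :=
  (∑ j, lineZ (a j) (φ j) • (Complex.ofRealCLM ∘L ContinuousLinearMap.proj j ∘L
    ContinuousLinearMap.fst ℝ (Fin n → ℝ) ℝ)) +
  (∑ j, lineZ (a j) (φ j) ^ 2 / 2) • (Complex.ofRealCLM ∘L
    ContinuousLinearMap.snd ℝ (Fin n → ℝ) ℝ)

lemma contourPhase_apply (a φ : Fin n → ℝ) (p : (Fin n → ℝ) × ℝ) :
    contourPhase a φ p =
      ∑ j, ((p.1 j : ℂ) * lineZ (a j) (φ j) + (p.2 : ℂ) / 2 * lineZ (a j) (φ j) ^ 2) := by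
  simp only [contourPhase, add_apply, sum_apply,
    smul_apply, ContinuousLinearMap.comp_apply, ContinuousLinearMap.proj_apply,
    ContinuousLinearMap.coe_fst', ContinuousLinearMap.coe_snd', Complex.ofRealCLM_apply,
    smul_eq_mul, Finset.sum_mul, ← Finset.sum_add_distrib]
  exact Finset.sum_congr rfl fun j _ => by ring

lemma continuous_contourPhase (a : Fin n → ℝ) : Continuous (contourPhase a) := by
  unfold contourPhase
  fun_prop

lemma hasPolynomialGrowth_contourPhase (a : Fin n → ℝ) :
    HasPolynomialGrowth (contourPhase a) := by
  refine .add (.sum _ fun j _ => (hasPolynomialGrowth_lineZ _ j).smul (.const _))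
    (.smul (.sum _ fun j _ => ?_) (.const _))
  simp only [sq, div_eq_mul_inv]
  exact ((hasPolynomialGrowth_lineZ _ j).mul (hasPolynomialGrowth_lineZ _ j)).mul (.const _)

lemma contourPhase_re (a φ : Fin n → ℝ) (p : (Fin n → ℝ) × ℝ) :
    (contourPhase a φ p).re =
      ∑ j, p.1 j * a j + p.2 / 2 * ∑ j, a j ^ 2 - p.2 / 2 * ∑ j, φ j ^ 2 := by
  rw [contourPhase_apply, Complex.re_sum, Finset.mul_sum, Finset.mul_sum,
    ← Finset.sum_add_distrib, ← Finset.sum_sub_distrib]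
  refine Finset.sum_congr rfl fun j _ => ?_
  have h2 : ((p.2 : ℂ) / 2) = ((p.2 / 2 : ℝ) : ℂ) := by push_cast; rfl
  rw [h2, Complex.add_re, Complex.re_ofReal_mul, Complex.re_ofReal_mul, lineZ_sq_re, lineZ_re]
  ring

lemma isDominatedAmplitude_contourPhase (a : Fin n → ℝ) {G : (Fin n → ℝ) → ℂ}
    (hGm : AEStronglyMeasurable G) (hG : HasPolynomialGrowth G) :
    IsDominatedAmplitude volume (contourPhase a) (univ ×ˢ Ioi (0 : ℝ)) G where
  aestronglyMeasurable := hGm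
  exists_bound p₀ hp₀ k := by
    have ht₀ : 0 < p₀.2 := hp₀.2
    obtain ⟨C, m, hC, hG⟩ := hG
    obtain ⟨D, l, hD, hL⟩ := hasPolynomialGrowth_contourPhase a
    set A : (Fin n → ℝ) × ℝ → ℝ := fun p => ∑ j, p.1 j * a j + p.2 / 2 * ∑ j, a j ^ 2 with hA
    have hAcont : Continuous A := by fun_prop
    refine ⟨fun φ => D ^ k * C * Real.exp (A p₀ + 1) *
      ((1 + ‖φ‖) ^ (l * k + m) * Real.exp (-(p₀.2 / 4) * ∑ j, φ j ^ 2)),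
      (integrable_pow_one_add_norm_mul_exp_neg_mul_sum_sq _ (by positivity)).const_mul _, ?_⟩
    have h1 : ∀ᶠ p in 𝓝 p₀, A p < A p₀ + 1 :=
      hAcont.continuousAt.eventually_lt_const (by linarith)
    have h2 : ∀ᶠ p : (Fin n → ℝ) × ℝ in 𝓝 p₀, p₀.2 / 2 < p.2 :=
      continuous_snd.continuousAt.eventually_const_lt (by linarith)
    filter_upwards [h1, h2] with p hp1 hp2 φ
    have hsum : 0 ≤ ∑ j, φ j ^ 2 := Finset.sum_nonneg fun j _ => sq_nonneg _
    have hexp : ‖Complex.exp (contourPhase a φ p)‖ ≤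
        Real.exp (A p₀ + 1) * Real.exp (-(p₀.2 / 4) * ∑ j, φ j ^ 2) := by
      rw [Complex.norm_exp, contourPhase_re, ← Real.exp_add, Real.exp_le_exp]
      have := mul_le_mul_of_nonneg_right hp2.le hsum
      simp only [hA] at hp1 ⊢
      linarith
    calc ‖contourPhase a φ‖ ^ k * (‖Complex.exp (contourPhase a φ p)‖ * ‖G φ‖)
        ≤ (D * (1 + ‖φ‖) ^ l) ^ k * ((Real.exp (A p₀ + 1) *
            Real.exp (-(p₀.2 / 4) * ∑ j, φ j ^ 2)) * (C * (1 + ‖φ‖) ^ m)) := by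
          gcongr
          · exact hL φ
          · exact hG φ
      _ = _ := by rw [mul_pow, ← pow_mul, pow_add]; ring

/-- The part of the integrand of `Ftilde` which does not depend on `(x, t)`. -/
noncomputable def contourAmplitude (τ : ℝ) (a φ : Fin n → ℝ) : ℂ :=
  (∏ j : Fin n,
    (1 / lineZ (a j) (φ j)) * (((τ : ℂ) - 1) / (lineZ (a j) (φ j) + (1 - (τ : ℂ))))) *
  ∏ pr ∈ Finset.univ.filter (fun pr : Fin n × Fin n => pr.1 < pr.2),
    ((lineZ (a pr.2) (φ pr.2) - lineZ (a pr.1) (φ pr.1)) /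
      (lineZ (a pr.2) (φ pr.2) - (τ : ℂ) * lineZ (a pr.1) (φ pr.1)))

lemma measurable_contourAmplitude (τ : ℝ) (a : Fin n → ℝ) :
    Measurable (contourAmplitude τ a) := by
  have h (j : Fin n) : Measurable fun φ : Fin n → ℝ => lineZ (a j) (φ j) :=
    (continuous_lineZ (a j)).measurable.comp (measurable_pi_apply j)
  unfold contourAmplitude
  fun_prop

lemma hasPolynomialGrowth_contourAmplitude {τ : ℝ} {a : Fin n → ℝ}
    (hlow : ∀ j, -(1 - τ) < a j) (hup : ∀ j, a j < 0)
    (hpair : ∀ i j, i < j → τ * a i < a j) :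
    HasPolynomialGrowth (contourAmplitude τ a) := by
  unfold contourAmplitude
  simp only [div_eq_mul_inv, one_mul]
  refine .mul (.prod _ fun j _ => .mul ?_ (.mul (.const _) ?_)) (.prod _ fun pr hpr => .mul ?_ ?_)
  · exact .inv_of_le_re (abs_pos.2 (hup j).ne) fun φ => by rw [lineZ_re]
  · refine .inv_of_le_re (c := a j + (1 - τ)) (by linarith [hlow j]) fun φ => ?_
    refine le_of_eq_of_le ?_ (le_abs_self _)
    simp
  · simp only [sub_eq_add_neg]
    exact (hasPolynomialGrowth_lineZ _ _).add
      ((hasPolynomialGrowth_lineZ _ _).of_norm_le fun φ => (norm_neg _).le)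
  · have h := hpair _ _ (Finset.mem_filter.1 hpr).2
    refine .inv_of_le_re (c := a pr.2 - τ * a pr.1) (by linarith) fun φ => ?_
    refine le_of_eq_of_le ?_ (le_abs_self _)
    simp

lemma Ftilde_eq (τ : ℝ) (a x : Fin n → ℝ) (t : ℝ) :
    Ftilde n τ a x t = (τ : ℂ) ^ (n * (n - 1) / 2) * (1 / (2 * Real.pi)) ^ n *
      ∫ φ, Complex.exp (contourPhase a φ (x, t)) * contourAmplitude τ a φ := by
  unfold Ftilde
  congr 2 with φ
  rw [contourPhase_apply, Complex.exp_sum, contourAmplitude, Finset.prod_mul_distrib]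
  ring

lemma mul_lt_of_consecutive {τ : ℝ} {a : Fin n → ℝ} (hmono : StrictMono a)
    (hgap : ∀ i j : Fin n, (i : ℕ) + 1 = (j : ℕ) → τ * a i < a j) (i j : Fin n) (hij : i < j) :
    τ * a i < a j := by
  have hlt : (i : ℕ) + 1 < n := lt_of_le_of_lt (Fin.lt_def.1 hij) j.isLt
  exact (hgap i ⟨i + 1, hlt⟩ rfl).trans_le (hmono.monotone (Fin.le_def.2 (Fin.lt_def.1 hij)))

end Contours

/-- `F̃_n` is smooth on `ℝⁿ × (0,∞)` and satisfies the backward heat equation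
`∂_t F̃_n = (1/2) Σ_j ∂²F̃_n/∂x_j²` there. -/
theorem Ftilde_smooth_and_heat (n : ℕ) (hn : 1 ≤ n) (τ : ℝ) (hτ : τ ∈ Set.Ioo (0 : ℝ) 1)
    (a : Fin n → ℝ) (hlow : ∀ j, -(1 - τ) < a j) (hup : ∀ j, a j < 0)
    (hmono : StrictMono a)
    (hgap : ∀ i j : Fin n, (i : ℕ) + 1 = (j : ℕ) → τ * a i < a j) :
    ContDiffOn ℝ (⊤ : ℕ∞) (fun p : (Fin n → ℝ) × ℝ => Ftilde n τ a p.1 p.2)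
      (Set.univ ×ˢ Set.Ioi (0 : ℝ)) ∧
    ∀ (x : Fin n → ℝ) (t : ℝ), 0 < t →
      deriv (fun s : ℝ => Ftilde n τ a x s) t =
        (1 / 2 : ℂ) * ∑ j : Fin n,
          deriv (fun u : ℝ =>
            deriv (fun v : ℝ => Ftilde n τ a (Function.update x j v) t) u) (x j) := by
  have hL : AEStronglyMeasurable (contourPhase a) volume :=
    (continuous_contourPhase a).aestronglyMeasurable
  have hG : IsDominatedAmplitude volume (contourPhase a) (univ ×ˢ Ioi (0 : ℝ))
      (contourAmplitude τ a) :=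
    isDominatedAmplitude_contourPhase a (measurable_contourAmplitude τ a).aestronglyMeasurable
      (hasPolynomialGrowth_contourAmplitude hlow hup (mul_lt_of_consecutive hmono hgap))
  simp only [Ftilde_eq]
  refine ⟨contDiffOn_const.mul (hG.contDiffOn (isOpen_univ.prod isOpen_Ioi) hL), ?_⟩
  intro x t ht
  have hmem (y : Fin n → ℝ) : (y, t) ∈ univ ×ˢ Ioi (0 : ℝ) := ⟨mem_univ _, ht⟩
  have htime : HasDerivAt (fun s : ℝ => (x, s)) ((0 : Fin n → ℝ), (1 : ℝ)) t :=
    (hasDerivAt_const t x).prodMk (hasDerivAt_id t)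
  have hspace (j : Fin n) (u : ℝ) : HasDerivAt (fun v : ℝ => (Function.update x j v, t))
      (Pi.single j (1 : ℝ), (0 : ℝ)) u :=
    (hasDerivAt_update x j u).prodMk (hasDerivAt_const u t)
  have hGj (j : Fin n) := hG.apply_mul hL (Pi.single j (1 : ℝ), (0 : ℝ))
  have hGjj (j : Fin n) := (hGj j).apply_mul hL (Pi.single j (1 : ℝ), (0 : ℝ))
  have hderiv (j : Fin n) (u : ℝ) :=
    ((hG.hasDerivAt_comp hL (hspace j u) (hmem _)).const_mul
      ((τ : ℂ) ^ (n * (n - 1) / 2) * (1 / (2 * Real.pi)) ^ n)).deriv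
  have hderiv₂ (j : Fin n) :=
    (((hGj j).hasDerivAt_comp hL (hspace j (x j)) (hmem _)).const_mul
      ((τ : ℂ) ^ (n * (n - 1) / 2) * (1 / (2 * Real.pi)) ^ n)).deriv
  simp only [Function.update_eq_self] at hderiv₂
  rw [((hG.hasDerivAt_comp hL htime (hmem x)).const_mul _).deriv]
  simp only [hderiv, hderiv₂]
  rw [← Finset.mul_sum, ← integral_finsetSum _ fun j _ => (hGjj j).integrable hL (hmem x),
    mul_left_comm (1 / 2 : ℂ)]
  congr 1
  rw [← integral_const_mul]
  refine integral_congr_ae (ae_of_all _ fun φ => ?_)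
  have hone : contourPhase a φ (0, 1) = 1 / 2 * ∑ j, lineZ (a j) (φ j) ^ 2 := by
    simp [contourPhase_apply, Finset.mul_sum]
  have hsingle (j : Fin n) : contourPhase a φ (Pi.single j 1, 0) = lineZ (a j) (φ j) := by
    simp [contourPhase_apply, Pi.single_apply, apply_ite Complex.ofReal]
  simp only [hone, hsingle, Finset.mul_sum, Finset.sum_mul]
  exact Finset.sum_congr rfl fun j _ => by ring
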